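/- arXiv:1910.10822 — 5 statements merged into one kernel-verified Lean document; each statement's English description precedes it below -/
import Mathlib

section
/- Let a, b ∈ ℝ^d have nonnegative entries with Σᵢ aᵢ = Σⱼ bⱼ = s > 0, let C be a d×d real matrix, let λ ≥ 0 and γ > 0. Then the entropy-regularized optimal transport objective F(P) = λ·Σ_{i,j} C_{ij}·P_{ij} + γ·H(P) has a unique global minimizer on the transport polytope U(a,b). -/
open Matrix

/-- The transport polytope `U(a,b)`: `d×d` real matrices with nonnegative entries,
row sums `a`, and column sums `b`. -/
def transportPolytope (d : ℕ) (a b : Fin d → ℝ) : Set (Matrix (Fin d) (Fin d) ℝ) :=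
  {P | (∀ i j, 0 ≤ P i j) ∧ (∀ i, ∑ j, P i j = a i) ∧ (∀ j, ∑ i, P i j = b j)}

/-- The entropy functional `H(P) = Σ_{i,j} P_{ij}(log P_{ij} − 1)`; since
`Real.log 0 = 0` in Mathlib, the convention `0·log 0 = 0` holds automatically. -/
noncomputable def matrixEntropy {d : ℕ} (P : Matrix (Fin d) (Fin d) ℝ) : ℝ :=
  ∑ i, ∑ j, P i j * (Real.log (P i j) - 1)

theorem convex_transportPolytope (d : ℕ) (a b : Fin d → ℝ) :
    Convex ℝ (transportPolytope d a b) := by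
  rintro P ⟨hP, hPa, hPb⟩ Q ⟨hQ, hQa, hQb⟩ s t hs ht hst
  refine ⟨fun i j => ?_, fun i => ?_, fun j => ?_⟩
  · have := mul_nonneg hs (hP i j)
    have := mul_nonneg ht (hQ i j)
    simp only [Matrix.add_apply, Matrix.smul_apply, smul_eq_mul]
    positivity
  · simp only [Matrix.add_apply, Matrix.smul_apply, smul_eq_mul, Finset.sum_add_distrib,
      ← Finset.mul_sum, hPa, hQa, ← add_mul, hst, one_mul]
  · simp only [Matrix.add_apply, Matrix.smul_apply, smul_eq_mul, Finset.sum_add_distrib,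
      ← Finset.mul_sum, hPb, hQb, ← add_mul, hst, one_mul]

theorem isClosed_transportPolytope (d : ℕ) (a b : Fin d → ℝ) :
    IsClosed (transportPolytope d a b) := by
  have hentry (i j : Fin d) : Continuous fun P : Matrix (Fin d) (Fin d) ℝ => P i j :=
    continuous_id.matrix_elem i j
  simp only [transportPolytope, Set.ofPred_and, Set.ofPred_forall]
  refine .inter ?_ (.inter ?_ ?_)
  · exact isClosed_iInter fun i => isClosed_iInter fun j =>
      isClosed_le continuous_const (hentry i j)
  · exact isClosed_iInter fun i =>
      isClosed_eq (continuous_finsetSum _ fun j _ => hentry i j) continuous_const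
  · exact isClosed_iInter fun j =>
      isClosed_eq (continuous_finsetSum _ fun i _ => hentry i j) continuous_const

theorem isCompact_transportPolytope (d : ℕ) (a b : Fin d → ℝ) :
    IsCompact (transportPolytope d a b) := by
  have hbox : IsCompact (Set.univ.pi fun i => Set.univ.pi fun _ => Set.Icc 0 (a i) :
      Set (Fin d → Fin d → ℝ)) :=
    isCompact_univ_pi fun i => isCompact_univ_pi fun _ => isCompact_Icc
  refine IsCompact.of_isClosed_subset (X := Matrix (Fin d) (Fin d) ℝ) hbox
    (isClosed_transportPolytope d a b) ?_
  rintro P ⟨hP, hPa, -⟩ i - j -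
  refine ⟨hP i j, ?_⟩
  rw [← hPa i]
  exact Finset.single_le_sum (f := fun j => P i j) (fun k _ => hP i k) (Finset.mem_univ j)

/-- The independent coupling `aᵢ bⱼ / s` lies in the transport polytope. -/
theorem transportPolytope_nonempty {d : ℕ} {a b : Fin d → ℝ} {s : ℝ} (hs : 0 < s)
    (ha : ∀ i, 0 ≤ a i) (hb : ∀ j, 0 ≤ b j) (hsa : ∑ i, a i = s) (hsb : ∑ j, b j = s) :
    (transportPolytope d a b).Nonempty := by
  refine ⟨Matrix.of fun i j => a i * b j / s, fun i j => ?_, fun i => ?_, fun j => ?_⟩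
  · exact div_nonneg (mul_nonneg (ha i) (hb j)) hs.le
  · simp only [Matrix.of_apply]
    rw [← Finset.sum_div, ← Finset.mul_sum, hsb, mul_div_cancel_right₀ _ hs.ne']
  · simp only [Matrix.of_apply]
    rw [← Finset.sum_div, ← Finset.sum_mul, hsa, mul_div_cancel_left₀ _ hs.ne']

theorem continuous_matrixEntropy {d : ℕ} :
    Continuous (matrixEntropy : Matrix (Fin d) (Fin d) ℝ → ℝ) := by
  have hentry (i j : Fin d) : Continuous fun P : Matrix (Fin d) (Fin d) ℝ => P i j :=
    continuous_id.matrix_elem i j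
  unfold matrixEntropy
  simp only [mul_sub, mul_one]
  exact continuous_finsetSum _ fun i _ => continuous_finsetSum _ fun j _ =>
    (Real.continuous_mul_log.comp (hentry i j)).sub (hentry i j)

theorem strictConvexOn_mul_log_sub_one :
    StrictConvexOn ℝ (Set.Ici 0) fun x : ℝ => x * (Real.log x - 1) := by
  simp only [mul_sub, mul_one]
  exact Real.strictConvexOn_mul_log.sub_concaveOn (concaveOn_id (convex_Ici 0))

theorem strictConvexOn_matrixEntropy (d : ℕ) (a b : Fin d → ℝ) :
    StrictConvexOn ℝ (transportPolytope d a b) matrixEntropy := by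
  refine ⟨convex_transportPolytope d a b, fun P hP Q hQ hPQ s t hs ht hst => ?_⟩
  have hle (i j : Fin d) := strictConvexOn_mul_log_sub_one.convexOn.2
    (hP.1 i j) (hQ.1 i j) hs.le ht.le hst
  obtain ⟨i, j, hij⟩ : ∃ i j, P i j ≠ Q i j := by
    by_contra! h
    exact hPQ (Matrix.ext h)
  simp only [matrixEntropy, Finset.smul_sum, ← Finset.sum_add_distrib]
  refine Finset.sum_lt_sum (fun i _ => Finset.sum_le_sum fun j _ => hle i j)
    ⟨i, Finset.mem_univ i, Finset.sum_lt_sum (fun j _ => hle i j) ⟨j, Finset.mem_univ j, ?_⟩⟩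
  exact strictConvexOn_mul_log_sub_one.2 (hP.1 i j) (hQ.1 i j) hij hs ht hst

/-- For `a, b ∈ ℝ^d` with nonnegative entries and common total mass `s > 0`, cost `C`,
`λ ≥ 0`, and `γ > 0`, the entropy-regularized optimal transport objective
`F(P) = λ·Σ C_{ij} P_{ij} + γ·H(P)` has a unique global minimizer on `U(a,b)`. -/
theorem stmt9 (d : ℕ) (a b : Fin d → ℝ) (s : ℝ) (hs : 0 < s)
    (ha : ∀ i, 0 ≤ a i) (hb : ∀ j, 0 ≤ b j)
    (hsa : ∑ i, a i = s) (hsb : ∑ j, b j = s)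
    (C : Matrix (Fin d) (Fin d) ℝ) (lam gamma : ℝ) (hlam : 0 ≤ lam) (hgamma : 0 < gamma) :
    ∃! P : Matrix (Fin d) (Fin d) ℝ, P ∈ transportPolytope d a b ∧
      ∀ Q ∈ transportPolytope d a b,
        lam * ∑ i, ∑ j, C i j * P i j + gamma * matrixEntropy P ≤
        lam * ∑ i, ∑ j, C i j * Q i j + gamma * matrixEntropy Q := by
  set F : Matrix (Fin d) (Fin d) ℝ → ℝ := fun P =>
    lam * ∑ i, ∑ j, C i j * P i j + gamma * matrixEntropy P
  have hcont : Continuous F := by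
    refine (continuous_const.mul ?_).add (continuous_const.mul continuous_matrixEntropy)
    exact continuous_finsetSum _ fun i _ => continuous_finsetSum _ fun j _ =>
      continuous_const.mul (continuous_id.matrix_elem i j)
  have hconv : StrictConvexOn ℝ (transportPolytope d a b) F := by
    refine ⟨convex_transportPolytope d a b, fun P hP Q hQ hPQ s t hs ht hst => ?_⟩
    have hH := mul_lt_mul_of_pos_left
      ((strictConvexOn_matrixEntropy d a b).2 hP hQ hPQ hs ht hst) hgamma
    have hlin : ∑ i, ∑ j, C i j * (s • P + t • Q) i j =
        s * ∑ i, ∑ j, C i j * P i j + t * ∑ i, ∑ j, C i j * Q i j := by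
      simp only [Finset.mul_sum, ← Finset.sum_add_distrib, Matrix.add_apply,
        Matrix.smul_apply, smul_eq_mul]
      refine Finset.sum_congr rfl fun i _ => Finset.sum_congr rfl fun j _ => ?_
      ring
    simp only [F, hlin, smul_eq_mul] at hH ⊢
    linarith
  obtain ⟨P, hP, hmin⟩ := (isCompact_transportPolytope d a b).exists_isMinOn
    (transportPolytope_nonempty hs ha hb hsa hsb) hcont.continuousOn
  exact ⟨P, ⟨hP, fun Q hQ => hmin hQ⟩, fun Q hQ =>
    hconv.eq_of_isMinOn (fun R hR => hQ.2 R hR) hmin hQ.1 hP⟩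
end

section
/- Let a, b ∈ ℝ^d have strictly positive entries with Σᵢ aᵢ = Σⱼ bⱼ, let C be a d×d real matrix, let λ ≥ 0 and γ > 0. Then the unique minimizer P* of F(P) = λ·Σ_{i,j} C_{ij}·P_{ij} + γ·H(P) over the transport polytope U(a,b) has all entries strictly positive: P*_{ij} > 0 for all i, j. -/
open Matrix

/-- The normalized product coupling belongs to the transport polytope. -/
theorem product_mem_transportPolytope {d : ℕ} {a b : Fin d → ℝ}
    (ha : ∀ i, 0 ≤ a i) (hb : ∀ j, 0 ≤ b j) (hab : ∑ i, a i = ∑ j, b j)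
    (hpos : 0 < ∑ i, a i) :
    (Matrix.of fun i j => a i * b j / ∑ k, a k) ∈ transportPolytope d a b := by
  refine ⟨fun i j => ?_, fun i => ?_, fun j => ?_⟩
  · exact div_nonneg (mul_nonneg (ha i) (hb j)) hpos.le
  · simp only [Matrix.of_apply]
    rw [← Finset.sum_div, ← Finset.mul_sum, ← hab, mul_div_cancel_right₀ _ hpos.ne']
  · simp only [Matrix.of_apply]
    rw [← Finset.sum_div, ← Finset.sum_mul, mul_div_cancel_left₀ _ hpos.ne']

/-- The scalar entropy `x (log x - 1)` is convex on the nonnegative reals. -/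
theorem convexOn_mul_log_sub_one :
    ConvexOn ℝ (Set.Ici 0) fun x : ℝ => x * (Real.log x - 1) := by
  refine (Real.convexOn_mul_log.sub (concaveOn_id (convex_Ici 0))).congr fun x _ => ?_
  simp only [Pi.sub_apply, id_eq]
  ring

/-- Convexity of the entropy along a segment leaving `P`, with the gain `t * q * log t`
contributed by an entry that vanishes at `P` and equals `q > 0` at the other endpoint. -/
theorem matrixEntropy_segment_le {d : ℕ} {P Q : Matrix (Fin d) (Fin d) ℝ}
    (hP : ∀ i j, 0 ≤ P i j) (hQ : ∀ i j, 0 ≤ Q i j) {k l : Fin d}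
    (hPkl : P k l = 0) (hQkl : 0 < Q k l) {t : ℝ} (ht : 0 < t) (ht1 : t ≤ 1) :
    matrixEntropy ((1 - t) • P + t • Q) ≤
      (1 - t) * matrixEntropy P + t * matrixEntropy Q + t * Q k l * Real.log t := by
  have hentry : ∀ i j, ((1 - t) • P + t • Q) i j * (Real.log (((1 - t) • P + t • Q) i j) - 1) ≤
      (1 - t) * (P i j * (Real.log (P i j) - 1)) + t * (Q i j * (Real.log (Q i j) - 1)) +
        (if i = k then if j = l then t * Q k l * Real.log t else 0 else 0) := by
    intro i j
    simp only [Matrix.add_apply, Matrix.smul_apply, smul_eq_mul]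
    by_cases h : i = k ∧ j = l
    · obtain ⟨rfl, rfl⟩ := h
      simp only [hPkl, if_true, mul_zero, zero_add, zero_mul]
      rw [Real.log_mul ht.ne' hQkl.ne']
      apply le_of_eq
      ring
    · have hzero : (if i = k then if j = l then t * Q k l * Real.log t else 0 else 0) = 0 := by
        split_ifs <;> tauto
      rw [hzero, add_zero]
      exact convexOn_mul_log_sub_one.2 (hP i j) (hQ i j) (sub_nonneg.2 ht1) ht.le (by ring)
  refine (Finset.sum_le_sum fun i _ => Finset.sum_le_sum fun j _ => hentry i j).trans_eq ?_
  simp [matrixEntropy, Finset.sum_add_distrib, Finset.mul_sum, Finset.sum_ite_irrel]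

/-- For `a, b ∈ ℝ^d` with strictly positive entries and equal total mass, cost `C`,
`λ ≥ 0`, and `γ > 0`, the (unique) minimizer `P*` of the entropy-regularized
objective `F(P) = λ·Σ C_{ij} P_{ij} + γ·H(P)` over `U(a,b)` has all entries
strictly positive. -/
theorem stmt10 (d : ℕ) (a b : Fin d → ℝ)
    (ha : ∀ i, 0 < a i) (hb : ∀ j, 0 < b j)
    (hab : ∑ i, a i = ∑ j, b j)
    (C : Matrix (Fin d) (Fin d) ℝ) (lam gamma : ℝ) (hlam : 0 ≤ lam) (hgamma : 0 < gamma)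
    (Pstar : Matrix (Fin d) (Fin d) ℝ) (hPstar : Pstar ∈ transportPolytope d a b)
    (hmin : ∀ Q ∈ transportPolytope d a b,
      lam * ∑ i, ∑ j, C i j * Pstar i j + gamma * matrixEntropy Pstar ≤
      lam * ∑ i, ∑ j, C i j * Q i j + gamma * matrixEntropy Q) :
    ∀ i j, 0 < Pstar i j := by
  intro k l
  have hpos : 0 < ∑ i, a i := Finset.sum_pos (fun i _ => ha i) ⟨k, Finset.mem_univ k⟩
  set Q : Matrix (Fin d) (Fin d) ℝ := Matrix.of fun i j => a i * b j / ∑ k, a k with hQdef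
  have hQ : Q ∈ transportPolytope d a b :=
    product_mem_transportPolytope (fun i => (ha i).le) (fun j => (hb j).le) hab hpos
  have hQkl : 0 < Q k l := div_pos (mul_pos (ha k) (hb l)) hpos
  by_contra hk
  have hPkl : Pstar k l = 0 := le_antisymm (not_lt.1 hk) (hPstar.1 k l)
  have hgap := sub_nonneg.2 (hmin Q hQ)
  set D := lam * ∑ i, ∑ j, C i j * Q i j + gamma * matrixEntropy Q -
    (lam * ∑ i, ∑ j, C i j * Pstar i j + gamma * matrixEntropy Pstar) with hD
  have hgq : 0 < gamma * Q k l := mul_pos hgamma hQkl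
  set t := Real.exp (-(D / (gamma * Q k l) + 1)) with ht_def
  have ht : 0 < t := Real.exp_pos _
  have ht1 : t ≤ 1 := by
    rw [ht_def, Real.exp_le_one_iff, neg_nonpos]
    positivity
  have hlog : gamma * Q k l * Real.log t = -D - gamma * Q k l := by
    rw [ht_def, Real.log_exp]
    field_simp
    ring
  have hle := hmin _ (convex_transportPolytope d a b hPstar hQ (sub_nonneg.2 ht1) ht.le (by ring))
  have hlin : ∑ i, ∑ j, C i j * ((1 - t) • Pstar + t • Q) i j =
      (1 - t) * ∑ i, ∑ j, C i j * Pstar i j + t * ∑ i, ∑ j, C i j * Q i j := by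
    simp only [Finset.mul_sum, ← Finset.sum_add_distrib, Matrix.add_apply, Matrix.smul_apply,
      smul_eq_mul]
    exact Finset.sum_congr rfl fun i _ => Finset.sum_congr rfl fun j _ => by ring
  have hent := mul_le_mul_of_nonneg_left
    (matrixEntropy_segment_le hPstar.1 hQ.1 hPkl hQkl ht ht1) hgamma.le
  rw [hlin] at hle
  have hcontra : 0 ≤ t * (D + gamma * Q k l * Real.log t) := by
    rw [hD]
    linarith
  rw [hlog] at hcontra
  nlinarith [mul_pos ht hgq]
end

section
/- Let a, b ∈ ℝ^d have strictly positive entries with Σᵢ aᵢ = Σⱼ bⱼ, let C be a d×d real matrix, let λ ≥ 0 and γ > 0, and set K_{ij} = exp(−λ·C_{ij}/γ). Suppose u, v ∈ ℝ^d have strictly positive entries and the matrix P with entries P_{ij} = uᵢ·K_{ij}·vⱼ belongs to the transport polytope U(a,b). Then P is the unique minimizer of F(P) = λ·Σ_{i,j} C_{ij}·P_{ij} + γ·H(P) over U(a,b). -/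
open Matrix

/-- The tangent-line inequality for the strictly convex function `q ↦ q * (log q - 1)` at `p`. -/
theorem mul_log_sub_lt_mul_log_sub_one {p q : ℝ} (hp : 0 < p) (hq : 0 ≤ q) (hne : q ≠ p) :
    q * Real.log p - p < q * (Real.log q - 1) := by
  rcases hq.eq_or_lt with rfl | hq
  · simpa using hp
  · have h := Real.log_lt_sub_one_of_pos (div_pos hp hq)
      (fun h => hne ((div_eq_one_iff_eq hq.ne').1 h).symm)
    rw [Real.log_div hp.ne' hq.ne'] at h
    have h' := mul_lt_mul_of_pos_left h hq
    have e : q * (p / q - 1) = p - q := by field_simp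
    linarith

/-- Additively separable costs are constant on the transport polytope. -/
theorem sum_add_mul_of_mem_transportPolytope {d : ℕ} {a b : Fin d → ℝ}
    {Q : Matrix (Fin d) (Fin d) ℝ} (hQ : Q ∈ transportPolytope d a b) (x y : Fin d → ℝ) :
    ∑ i, ∑ j, (x i + y j) * Q i j = ∑ i, x i * a i + ∑ j, y j * b j := by
  simp only [add_mul, Finset.sum_add_distrib]
  congr 1
  · simp only [← Finset.mul_sum, hQ.2.1]
  · rw [Finset.sum_comm]
    simp only [← Finset.mul_sum, hQ.2.2]

/-- KKT sufficiency for entropic optimal transport: if `K_{ij} = exp(−λC_{ij}/γ)` and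
`P_{ij} = uᵢ·K_{ij}·vⱼ` for strictly positive `u, v`, and `P ∈ U(a,b)`, then `P` is
the unique minimizer of `F(P) = λ·Σ C_{ij} P_{ij} + γ·H(P)` over `U(a,b)`. -/
theorem stmt12 (d : ℕ) (a b : Fin d → ℝ)
    (ha : ∀ i, 0 < a i) (hb : ∀ j, 0 < b j)
    (hab : ∑ i, a i = ∑ j, b j)
    (C : Matrix (Fin d) (Fin d) ℝ) (lam gamma : ℝ) (hlam : 0 ≤ lam) (hgamma : 0 < gamma)
    (K : Matrix (Fin d) (Fin d) ℝ)
    (hK : ∀ i j, K i j = Real.exp (-(lam * C i j) / gamma))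
    (u v : Fin d → ℝ) (hu : ∀ i, 0 < u i) (hv : ∀ j, 0 < v j)
    (P : Matrix (Fin d) (Fin d) ℝ) (hP : ∀ i j, P i j = u i * K i j * v j)
    (hPU : P ∈ transportPolytope d a b) :
    ∀ Q ∈ transportPolytope d a b, Q ≠ P →
      lam * ∑ i, ∑ j, C i j * P i j + gamma * matrixEntropy P <
      lam * ∑ i, ∑ j, C i j * Q i j + gamma * matrixEntropy Q := by
  intro Q hQ hne
  have hpos : ∀ i j, 0 < P i j := fun i j => by
    rw [hP, hK]
    exact mul_pos (mul_pos (hu i) (Real.exp_pos _)) (hv j)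
  have hcost : ∀ i j, lam * C i j =
      gamma * (Real.log (u i) + Real.log (v j) - Real.log (P i j)) := fun i j => by
    rw [hP, hK, Real.log_mul (mul_pos (hu i) (Real.exp_pos _)).ne' (hv j).ne',
      Real.log_mul (hu i).ne' (Real.exp_pos _).ne', Real.log_exp]
    field_simp
    ring
  have hobj : ∀ R ∈ transportPolytope d a b,
      lam * ∑ i, ∑ j, C i j * R i j + gamma * matrixEntropy R =
        gamma * (∑ i, Real.log (u i) * a i + ∑ j, Real.log (v j) * b j) +
        gamma * ∑ i, ∑ j, (R i j * (Real.log (R i j) - 1) - R i j * Real.log (P i j)) := by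
    intro R hR
    rw [← sum_add_mul_of_mem_transportPolytope hR]
    simp only [matrixEntropy, Finset.mul_sum, ← Finset.sum_add_distrib]
    refine Finset.sum_congr rfl fun i _ => Finset.sum_congr rfl fun j _ => ?_
    rw [← mul_assoc, hcost]
    ring
  have hlt : ∀ i j, Q i j ≠ P i j →
      P i j * (Real.log (P i j) - 1) - P i j * Real.log (P i j) <
        Q i j * (Real.log (Q i j) - 1) - Q i j * Real.log (P i j) := fun i j h => by
    linarith [mul_log_sub_lt_mul_log_sub_one (hpos i j) (hQ.1 i j) h]
  have hle : ∀ i j,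
      P i j * (Real.log (P i j) - 1) - P i j * Real.log (P i j) ≤
        Q i j * (Real.log (Q i j) - 1) - Q i j * Real.log (P i j) := fun i j => by
    by_cases h : Q i j = P i j
    · rw [h]
    · exact (hlt i j h).le
  obtain ⟨i, j, hij⟩ : ∃ i j, Q i j ≠ P i j := by
    by_contra! h
    exact hne (Matrix.ext h)
  rw [hobj P hPU, hobj Q hQ]
  gcongr ?_ + gamma * ?_
  exact Finset.sum_lt_sum (fun i _ => Finset.sum_le_sum fun j _ => hle i j)
    ⟨i, Finset.mem_univ i, Finset.sum_lt_sum (fun j _ => hle i j)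
      ⟨j, Finset.mem_univ j, hlt i j hij⟩⟩
end

section
/- Let K be a d×d real matrix with strictly positive entries and let a, b ∈ ℝ^d have strictly positive entries with Σᵢ aᵢ = Σⱼ bⱼ. Then there exist vectors u, v ∈ ℝ^d with strictly positive entries such that the matrix P with entries P_{ij} = uᵢ·K_{ij}·vⱼ has row sums a and column sums b (i.e., P ∈ U(a,b)). -/
open Matrix

section Sinkhorn

lemma mulVec_pos_of_pos {ι κ : Type*} [Fintype κ] {K : Matrix ι κ ℝ} (hK : ∀ i j, 0 < K i j)
    {w : κ → ℝ} (hw : ∀ j, 0 ≤ w j) (hw' : 0 < ∑ j, w j) (i : ι) : 0 < (K *ᵥ w) i := by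
  obtain ⟨j, hj, hwj⟩ := Finset.exists_lt_of_sum_lt (f := fun _ : κ => (0 : ℝ)) (by simpa using hw')
  exact Finset.sum_pos' (fun j _ => mul_nonneg (hK i j).le (hw j))
    ⟨j, hj, mul_pos (hK i j) hwj⟩

variable {ι κ : Type*} [Fintype ι] [Fintype κ]

/-- The logarithmic potential whose maximizers over the positive orthant are the column scalings
in Sinkhorn's theorem. -/
noncomputable def sinkhornPotential (K : Matrix ι κ ℝ) (a : ι → ℝ) (b : κ → ℝ) (w : κ → ℝ) : ℝ :=
  ∑ j, b j * Real.log (w j) - ∑ i, a i * Real.log ((K *ᵥ w) i)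

lemma sinkhornPotential_smul {K : Matrix ι κ ℝ} {a : ι → ℝ} {b : κ → ℝ}
    (hab : ∑ i, a i = ∑ j, b j) {w : κ → ℝ} (hw : ∀ j, w j ≠ 0)
    (hKw : ∀ i, (K *ᵥ w) i ≠ 0) {c : ℝ} (hc : c ≠ 0) :
    sinkhornPotential K a b (c • w) = sinkhornPotential K a b w := by
  simp only [sinkhornPotential, Matrix.mulVec_smul, Pi.smul_apply, smul_eq_mul,
    Real.log_mul hc (hw _), Real.log_mul hc (hKw _), mul_add, Finset.sum_add_distrib,
    ← Finset.sum_mul, hab]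
  ring

lemma log_prod_rpow_div_eq_sinkhornPotential {K : Matrix ι κ ℝ} {a : ι → ℝ} {b : κ → ℝ}
    {w : κ → ℝ} (hw : ∀ j, 0 < w j) (hKw : ∀ i, 0 < (K *ᵥ w) i) :
    Real.log ((∏ j, w j ^ b j) / ∏ i, (K *ᵥ w) i ^ a i) = sinkhornPotential K a b w := by
  have h₁ : ∀ j, w j ^ b j ≠ 0 := fun j => (Real.rpow_pos_of_pos (hw j) _).ne'
  have h₂ : ∀ i, (K *ᵥ w) i ^ a i ≠ 0 := fun i => (Real.rpow_pos_of_pos (hKw i) _).ne'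
  rw [Real.log_div (Finset.prod_ne_zero_iff.2 fun j _ => h₁ j)
    (Finset.prod_ne_zero_iff.2 fun i _ => h₂ i), Real.log_prod fun j _ => h₁ j,
    Real.log_prod fun i _ => h₂ i]
  simp only [sinkhornPotential, Real.log_rpow (hw _), Real.log_rpow (hKw _)]

lemma exists_forall_sinkhornPotential_le {K : Matrix ι κ ℝ} (hK : ∀ i j, 0 < K i j)
    {a : ι → ℝ} {b : κ → ℝ} (hb : ∀ j, 0 < b j) (hab : ∑ i, a i = ∑ j, b j) :
    ∃ v : κ → ℝ, (∀ j, 0 < v j) ∧ ∀ w : κ → ℝ, (∀ j, 0 < w j) →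
      sinkhornPotential K a b w ≤ sinkhornPotential K a b v := by
  classical
  rcases isEmpty_or_nonempty κ with hκ | hκ
  · exact ⟨isEmptyElim, isEmptyElim, fun w _ => by rw [Subsingleton.elim w]⟩
  let g : (κ → ℝ) → ℝ := fun w => (∏ j, w j ^ b j) / ∏ i, (K *ᵥ w) i ^ a i
  have hKpos : ∀ w ∈ stdSimplex ℝ κ, ∀ i, 0 < (K *ᵥ w) i := fun w hw =>
    mulVec_pos_of_pos hK hw.1 (hw.2 ▸ one_pos)
  have hgpos : ∀ w ∈ stdSimplex ℝ κ, (∀ j, 0 < w j) → 0 < g w := fun w hw hw' =>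
    div_pos (Finset.prod_pos fun j _ => Real.rpow_pos_of_pos (hw' j) _)
      (Finset.prod_pos fun i _ => Real.rpow_pos_of_pos (hKpos w hw i) _)
  have hnormalize : ∀ w : κ → ℝ, (∀ j, 0 < w j) → (∑ j, w j)⁻¹ • w ∈ stdSimplex ℝ κ ∧
      ∀ j, 0 < ((∑ j, w j)⁻¹ • w) j := fun w hw => by
    have hs : 0 < ∑ j, w j := Finset.sum_pos (fun j _ => hw j) Finset.univ_nonempty
    have hpos : ∀ j, 0 < ((∑ j, w j)⁻¹ • w) j := fun j => mul_pos (inv_pos.2 hs) (hw j)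
    refine ⟨⟨fun j => (hpos j).le, ?_⟩, hpos⟩
    simp only [Pi.smul_apply, smul_eq_mul, ← Finset.mul_sum]
    exact inv_mul_cancel₀ hs.ne'
  have hg : ContinuousOn g (stdSimplex ℝ κ) := by
    refine ContinuousOn.div ?_ ?_ fun w hw => (Finset.prod_pos fun i _ =>
      Real.rpow_pos_of_pos (hKpos w hw i) _).ne'
    · exact continuousOn_finsetProd _ fun j _ =>
        (continuous_apply j).continuousOn.rpow_const fun _ _ => Or.inr (hb j).le
    · refine continuousOn_finsetProd _ fun i _ => ContinuousOn.rpow_const ?_ fun w hw =>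
        Or.inl (hKpos w hw i).ne'
      exact Continuous.continuousOn (by unfold Matrix.mulVec dotProduct; fun_prop)
  obtain ⟨v, hv, hmax⟩ := (isCompact_stdSimplex ℝ κ).exists_isMaxOn
    ⟨_, (hnormalize 1 fun _ => one_pos).1⟩ hg
  have hvpos : ∀ j, 0 < v j := fun j => (hv.1 j).lt_of_ne' fun h0 => by
    obtain ⟨h₁, h₂⟩ := hnormalize 1 fun _ => one_pos
    have hgv : g v = 0 := by
      have : ∏ j, v j ^ b j = 0 := Finset.prod_eq_zero (Finset.mem_univ j)
        (by rw [h0, Real.zero_rpow (hb j).ne'])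
      simp only [g, this, zero_div]
    exact (hgpos _ h₁ h₂).not_ge (hgv ▸ hmax h₁)
  refine ⟨v, hvpos, fun w hw => ?_⟩
  have hs : 0 < ∑ j, w j := Finset.sum_pos (fun j _ => hw j) Finset.univ_nonempty
  obtain ⟨h₁, h₂⟩ := hnormalize w hw
  rw [← sinkhornPotential_smul hab (fun j => (hw j).ne')
    (fun i => (mulVec_pos_of_pos hK (fun j => (hw j).le) hs i).ne') (inv_ne_zero hs.ne'),
    ← log_prod_rpow_div_eq_sinkhornPotential h₂ (hKpos _ h₁),
    ← log_prod_rpow_div_eq_sinkhornPotential hvpos (hKpos v hv)]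
  exact Real.log_le_log (hgpos _ h₁ h₂) (hmax h₁)

lemma hasDerivAt_sinkhornPotential_add_single [DecidableEq κ] {K : Matrix ι κ ℝ} {a : ι → ℝ}
    {b : κ → ℝ} {v : κ → ℝ} (hv : ∀ j, v j ≠ 0) (hKv : ∀ i, (K *ᵥ v) i ≠ 0) (k : κ) :
    HasDerivAt (fun t : ℝ => sinkhornPotential K a b (v + Pi.single k t))
      (b k / v k - ∑ i, a i / (K *ᵥ v) i * K i k) 0 := by
  have hcol : ∀ j, HasDerivAt (fun t : ℝ => b j * Real.log (v j + (Pi.single k t : κ → ℝ) j))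
      (if j = k then b k / v k else 0) 0 := fun j => by
    by_cases hj : j = k
    · subst hj
      have h := (((hasDerivAt_id (0 : ℝ)).const_add (v j)).log (by simpa using hv j)).const_mul (b j)
      simpa [div_eq_mul_inv] using h
    · simpa [hj] using hasDerivAt_const (0 : ℝ) (b j * Real.log (v j))
  have hrow : ∀ i, HasDerivAt (fun t : ℝ => a i * Real.log ((K *ᵥ v) i + K i k * t))
      (a i / (K *ᵥ v) i * K i k) 0 := fun i => by
    have h := ((((hasDerivAt_id (0 : ℝ)).const_mul (K i k)).const_add ((K *ᵥ v) i)).log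
      (by simpa using hKv i)).const_mul (a i)
    simpa [mul_div_assoc', div_mul_eq_mul_div] using h
  have h := (HasDerivAt.fun_sum fun j (_ : j ∈ Finset.univ) => hcol j).sub
    (HasDerivAt.fun_sum fun i (_ : i ∈ Finset.univ) => hrow i)
  rw [Finset.sum_ite_eq' Finset.univ k, if_pos (Finset.mem_univ k)] at h
  refine h.congr_of_eventuallyEq (.of_forall fun t => ?_)
  simp [sinkhornPotential, Matrix.mulVec_add, mul_comm]

lemma sum_div_mulVec_mul_eq_of_forall_sinkhornPotential_le {K : Matrix ι κ ℝ} {a : ι → ℝ}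
    {b : κ → ℝ} {v : κ → ℝ} (hv : ∀ j, 0 < v j) (hKv : ∀ i, (K *ᵥ v) i ≠ 0)
    (hmax : ∀ w : κ → ℝ, (∀ j, 0 < w j) → sinkhornPotential K a b w ≤ sinkhornPotential K a b v)
    (k : κ) : ∑ i, a i / (K *ᵥ v) i * K i k = b k / v k := by
  classical
  have hloc : IsLocalMax (fun t : ℝ => sinkhornPotential K a b (v + Pi.single k t)) 0 := by
    filter_upwards [lt_mem_nhds (neg_lt_zero.2 (hv k))] with t ht
    simp only [Pi.single_zero, add_zero]
    refine hmax _ fun j => ?_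
    by_cases hj : j = k
    · subst hj
      simpa using neg_lt_iff_pos_add'.1 ht
    · simpa [hj] using hv j
  exact (sub_eq_zero.1 (hloc.hasDerivAt_eq_zero
    (hasDerivAt_sinkhornPotential_add_single (fun j => (hv j).ne') hKv k))).symm

end Sinkhorn

/-- Sinkhorn's theorem (existence): for a `d×d` matrix `K` with strictly positive
entries and strictly positive marginals `a, b` of equal total mass, there exist
strictly positive vectors `u, v` such that `P_{ij} = uᵢ·K_{ij}·vⱼ` has row sums `a`
and column sums `b`, i.e. `P ∈ U(a,b)`. -/
theorem stmt13 (d : ℕ) (K : Matrix (Fin d) (Fin d) ℝ) (hK : ∀ i j, 0 < K i j)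
    (a b : Fin d → ℝ) (ha : ∀ i, 0 < a i) (hb : ∀ j, 0 < b j)
    (hab : ∑ i, a i = ∑ j, b j) :
    ∃ u v : Fin d → ℝ, (∀ i, 0 < u i) ∧ (∀ j, 0 < v j) ∧
      (Matrix.of fun i j => u i * K i j * v j) ∈ transportPolytope d a b := by
  obtain ⟨v, hv, hmax⟩ := exists_forall_sinkhornPotential_le hK hb hab
  have hKv : ∀ i, 0 < (K *ᵥ v) i := fun i =>
    mulVec_pos_of_pos hK (fun j => (hv j).le) (Finset.sum_pos (fun j _ => hv j) ⟨i, by simp⟩) i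
  have hu : ∀ i, 0 < a i / (K *ᵥ v) i := fun i => div_pos (ha i) (hKv i)
  refine ⟨fun i => a i / (K *ᵥ v) i, v, hu, hv,
    fun i j => (mul_pos (mul_pos (hu i) (hK i j)) (hv j)).le, fun i => ?_, fun j => ?_⟩
  · simp only [Matrix.of_apply, mul_assoc, ← Finset.mul_sum]
    exact div_mul_cancel₀ (a i) (hKv i).ne'
  · simp only [Matrix.of_apply, ← Finset.sum_mul]
    rw [sum_div_mulVec_mul_eq_of_forall_sinkhornPotential_le hv (fun i => (hKv i).ne') hmax j,
      div_mul_cancel₀ _ (hv j).ne']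
end

section
/- Let K be a d×d real matrix with strictly positive entries, and let u, v, u', v' ∈ ℝ^d have strictly positive entries such that uᵢ·K_{ij}·vⱼ = u'ᵢ·K_{ij}·v'ⱼ for all i, j. Then there exists a scalar s > 0 such that u' = s·u and v' = s⁻¹·v; i.e., the diagonal scalings of a positive matrix are unique up to a multiplicative constant. -/
open Matrix

/-- Sinkhorn's theorem (uniqueness): diagonal scalings of a strictly positive matrix
are unique up to a multiplicative constant: if `uᵢ·K_{ij}·vⱼ = u'ᵢ·K_{ij}·v'ⱼ` for all
`i, j`, with all vectors strictly positive, then `u' = s·u` and `v' = s⁻¹·v` for some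
scalar `s > 0`. -/
theorem stmt14 (d : ℕ) (K : Matrix (Fin d) (Fin d) ℝ) (hK : ∀ i j, 0 < K i j)
    (u v u' v' : Fin d → ℝ)
    (hu : ∀ i, 0 < u i) (hv : ∀ j, 0 < v j)
    (hu' : ∀ i, 0 < u' i) (hv' : ∀ j, 0 < v' j)
    (h : ∀ i j, u i * K i j * v j = u' i * K i j * v' j) :
    ∃ s : ℝ, 0 < s ∧ u' = s • u ∧ v' = s⁻¹ • v := by
  have huv : ∀ i j, u i * v j = u' i * v' j := fun i j =>
    mul_right_cancel₀ (hK i j).ne' (by linear_combination h i j)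
  rcases isEmpty_or_nonempty (Fin d) with _ | ⟨⟨k⟩⟩
  · exact ⟨1, one_pos, Subsingleton.elim _ _, Subsingleton.elim _ _⟩
  have hs : ∀ i, u' i = v k / v' k * u i := fun i => by
    rw [div_mul_eq_mul_div, eq_div_iff (hv' k).ne', mul_comm (v k), huv i k]
  have hpos : 0 < v k / v' k := div_pos (hv k) (hv' k)
  refine ⟨v k / v' k, hpos, funext hs, funext fun j => ?_⟩
  rw [Pi.smul_apply, smul_eq_mul, eq_inv_mul_iff_mul_eq₀ hpos.ne']
  refine mul_left_cancel₀ (hu k).ne' ?_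
  rw [huv k j, hs k]
  ring
end
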